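/- arXiv:2508.00333 — 2 statements merged into one kernel-verified Lean document; each statement's English description precedes it below -/
import Mathlib

section
/- For every constant c ∈ (0,1] there exists a constant C > 0, depending only on c, with the following property: for every p ≥ 1, every p×p real symmetric positive definite matrix Σ all of whose eigenvalues lie in the interval [c, 1/c], every random vector u uniformly distributed on the unit sphere S^{p−1} ⊂ ℝ^p, and all indices i, j ∈ {1,…,p}, one has |E[u_i u_j / (uᵀ Σ u)] − δ_{ij}/tr(Σ)| ≤ C p^{−3/2}, where δ_{ij} = 1 if i = j and δ_{ij} = 0 otherwise. -/
open MeasureTheory Finset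

noncomputable section

/-- A random vector `X` with values in Euclidean space is uniformly distributed on the unit
sphere if it is measurable, almost surely of norm one, and its law is invariant under every
orthogonal transformation (linear isometric equivalence). -/
def IsUniformOnSphere {ι : Type*} [Fintype ι] {Ω : Type*} [MeasureSpace Ω]
    (X : Ω → EuclideanSpace ℝ ι) : Prop :=
  Measurable X ∧ (∀ᵐ ω, ‖X ω‖ = 1) ∧
  ∀ O : EuclideanSpace ℝ ι ≃ₗᵢ[ℝ] EuclideanSpace ℝ ι,
    Measure.map (fun ω => O (X ω)) volume = Measure.map X volume

section UniformOnSphere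

variable {ι : Type*} [Fintype ι] {Ω : Type*} [MeasureSpace Ω]

/-- The reflection of the plane of two coordinates that maps `(x, y)` to
`((x + y) / √2, (x - y) / √2)`, acting as the identity on the other coordinates. -/
def planeReflection [DecidableEq ι] (k l : ι) (hkl : k ≠ l) :
    EuclideanSpace ℝ ι ≃ₗᵢ[ℝ] EuclideanSpace ℝ ι where
  toLinearEquiv := LinearEquiv.ofInvolutive
    { toFun := fun x => WithLp.toLp 2 fun m =>
        if m = k then (x k + x l) / √2 else if m = l then (x k - x l) / √2 else x m
      map_add' := fun x y => by
        ext m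
        simp only [PiLp.add_apply]
        split_ifs <;> ring
      map_smul' := fun a x => by
        ext m
        simp only [PiLp.smul_apply, smul_eq_mul, RingHom.id_apply]
        split_ifs <;> ring }
    (fun x => by
      have h2 : (√2 : ℝ) * √2 = 2 := Real.mul_self_sqrt (by norm_num)
      have h0 : (√2 : ℝ) ≠ 0 := by positivity
      ext m
      simp only [LinearMap.coe_mk, AddHom.coe_mk, if_true, hkl.symm, if_false]
      split_ifs with h h'
      · subst h
        field_simp
        linear_combination (-x m) * h2
      · subst h'
        field_simp
        linear_combination (-x m) * h2
      · rfl)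
  norm_map' := fun x => by
    have h2 : (√2 : ℝ) ^ 2 = 2 := Real.sq_sqrt (by norm_num)
    rw [← sq_eq_sq₀ (norm_nonneg _) (norm_nonneg _), EuclideanSpace.real_norm_sq_eq,
      EuclideanSpace.real_norm_sq_eq, ← sub_eq_zero, ← Finset.sum_sub_distrib,
      Finset.sum_eq_add k l hkl]
    · simp only [LinearEquiv.coe_ofInvolutive, LinearMap.coe_mk, AddHom.coe_mk, if_true,
        hkl.symm, if_false, div_pow, h2]
      ring
    · intro m _ hm
      simp [hm.1, hm.2]
    · simp
    · simp

lemma planeReflection_apply_left [DecidableEq ι] (k l : ι) (hkl : k ≠ l) (x : EuclideanSpace ℝ ι) :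
    planeReflection k l hkl x k = (x k + x l) / √2 := by
  change (if k = k then _ else _) = _
  simp

lemma planeReflection_apply_right [DecidableEq ι] (k l : ι) (hkl : k ≠ l) (x : EuclideanSpace ℝ ι) :
    planeReflection k l hkl x l = (x k - x l) / √2 := by
  change (if l = k then _ else if l = l then _ else _) = _
  simp [hkl.symm]

namespace IsUniformOnSphere

variable {X : Ω → EuclideanSpace ℝ ι}

lemma measurable_coord (hX : IsUniformOnSphere X) (k : ι) : Measurable fun ω => X ω k := by
  have := hX.1
  fun_prop

lemma isometry_comp (hX : IsUniformOnSphere X)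
    (O : EuclideanSpace ℝ ι ≃ₗᵢ[ℝ] EuclideanSpace ℝ ι) :
    IsUniformOnSphere fun ω => O (X ω) := by
  have hO : Measurable O := O.continuous.measurable
  refine ⟨hO.comp hX.1, ?_, fun Q => ?_⟩
  · filter_upwards [hX.2.1] with ω h
    rw [O.norm_map, h]
  · rw [hX.2.2 O]
    exact hX.2.2 (O.trans Q)

lemma integral_isometry (hX : IsUniformOnSphere X)
    (O : EuclideanSpace ℝ ι ≃ₗᵢ[ℝ] EuclideanSpace ℝ ι) {f : EuclideanSpace ℝ ι → ℝ}
    (hf : Measurable f) : ∫ ω, f (O (X ω)) = ∫ ω, f (X ω) := by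
  have hO : Measurable O := O.continuous.measurable
  rw [← integral_map (φ := X) hX.1.aemeasurable hf.aestronglyMeasurable, ← hX.2.2 O,
    integral_map (φ := fun ω => O (X ω)) (hO.comp hX.1).aemeasurable hf.aestronglyMeasurable]

lemma ae_abs_coord_le (hX : IsUniformOnSphere X) (k : ι) : ∀ᵐ ω, |X ω k| ≤ 1 := by
  filter_upwards [hX.2.1] with ω h
  rw [← h]
  exact PiLp.norm_apply_le (X ω) k

lemma ae_sum_sq (hX : IsUniformOnSphere X) : ∀ᵐ ω, ∑ k, X ω k ^ 2 = 1 := by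
  filter_upwards [hX.2.1] with ω h
  rw [← EuclideanSpace.real_norm_sq_eq, h, one_pow]

lemma integral_comp_coord_eq [DecidableEq ι] (hX : IsUniformOnSphere X) (k l : ι) {f : ℝ → ℝ}
    (hf : Measurable f) : ∫ ω, f (X ω k) = ∫ ω, f (X ω l) := by
  have h := hX.integral_isometry
    (LinearIsometryEquiv.piLpCongrLeft 2 ℝ ℝ (Equiv.swap k l)) (f := fun x => f (x l))
    (by fun_prop)
  simpa [LinearIsometryEquiv.piLpCongrLeft_apply, Equiv.piCongrLeft'_apply] using h

variable [IsProbabilityMeasure (volume : Measure Ω)]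

lemma integrable_mul (hX : IsUniformOnSphere X) (k l : ι) :
    Integrable fun ω => X ω k * X ω l := by
  have hm := hX.measurable_coord
  refine Integrable.of_bound (C := 1) ((hm k).mul (hm l)).aestronglyMeasurable ?_
  filter_upwards [hX.ae_abs_coord_le k, hX.ae_abs_coord_le l] with ω hk hl
  rw [Real.norm_eq_abs, abs_mul]
  exact mul_le_one₀ hk (abs_nonneg _) hl

lemma integrable_sq (hX : IsUniformOnSphere X) (k : ι) :
    Integrable fun ω => X ω k ^ 2 := by
  simpa only [sq] using hX.integrable_mul k k

lemma integrable_sq_mul_sq (hX : IsUniformOnSphere X) (k l : ι) :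
    Integrable fun ω => X ω k ^ 2 * X ω l ^ 2 := by
  have hm := hX.measurable_coord
  refine Integrable.of_bound (C := 1)
    (((hm k).pow_const 2).mul ((hm l).pow_const 2)).aestronglyMeasurable ?_
  filter_upwards [hX.ae_abs_coord_le k, hX.ae_abs_coord_le l] with ω hk hl
  rw [Real.norm_eq_abs, abs_mul, abs_pow, abs_pow]
  exact mul_le_one₀ (pow_le_one₀ (abs_nonneg _) hk) (by positivity)
    (pow_le_one₀ (abs_nonneg _) hl)

lemma integral_sq (hX : IsUniformOnSphere X) (k : ι) :
    ∫ ω, X ω k ^ 2 = 1 / (Fintype.card ι : ℝ) := by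
  classical
  have hsum : ∑ l, ∫ ω, X ω l ^ 2 = 1 := by
    rw [← integral_finsetSum _ fun l _ => hX.integrable_sq l, integral_congr_ae hX.ae_sum_sq]
    simp
  have hcard : (Fintype.card ι : ℝ) ≠ 0 := by
    have : Nonempty ι := ⟨k⟩
    exact_mod_cast Fintype.card_ne_zero
  simp_rw [fun l => hX.integral_comp_coord_eq l k (f := fun y => y ^ 2) (by fun_prop)] at hsum
  rw [Finset.sum_const, nsmul_eq_mul, Finset.card_univ] at hsum
  field_simp
  linarith

lemma integral_mul_of_ne (hX : IsUniformOnSphere X) {k l : ι} (hkl : k ≠ l) :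
    ∫ ω, X ω k * X ω l = 0 := by
  classical
  have h := hX.integral_isometry (planeReflection k l hkl) (f := fun x => x k * x l)
    (by fun_prop)
  have h2 : (√2 : ℝ) ^ 2 = 2 := Real.sq_sqrt (by norm_num)
  have hpt : ∀ x : EuclideanSpace ℝ ι,
      planeReflection k l hkl x k * planeReflection k l hkl x l = (x k ^ 2 - x l ^ 2) / 2 := by
    intro x
    rw [planeReflection_apply_left, planeReflection_apply_right, div_mul_div_comm, ← sq, h2]
    ring
  simp_rw [hpt] at h
  rw [← h, integral_div, integral_sub (hX.integrable_sq k) (hX.integrable_sq l),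
    hX.integral_sq, hX.integral_sq, sub_self, zero_div]

lemma integral_mul [DecidableEq ι] (hX : IsUniformOnSphere X) (k l : ι) :
    ∫ ω, X ω k * X ω l = (if k = l then (1 : ℝ) else 0) / Fintype.card ι := by
  split_ifs with h
  · subst h
    simpa only [sq] using hX.integral_sq k
  · rw [hX.integral_mul_of_ne h, zero_div]

lemma three_mul_integral_sq_mul_sq (hX : IsUniformOnSphere X) {k l : ι} (hkl : k ≠ l) :
    3 * ∫ ω, X ω k ^ 2 * X ω l ^ 2 = ∫ ω, X ω k ^ 2 * X ω k ^ 2 := by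
  classical
  have h := hX.integral_isometry (planeReflection k l hkl) (f := fun x => x k ^ 2 * x l ^ 2)
    (by fun_prop)
  have h2 : (√2 : ℝ) ^ 2 = 2 := Real.sq_sqrt (by norm_num)
  have hpt : ∀ x : EuclideanSpace ℝ ι,
      planeReflection k l hkl x k ^ 2 * planeReflection k l hkl x l ^ 2 =
        (x k ^ 2 * x k ^ 2 + x l ^ 2 * x l ^ 2 - 2 * (x k ^ 2 * x l ^ 2)) / 4 := by
    intro x
    rw [planeReflection_apply_left, planeReflection_apply_right, div_pow, div_pow, h2]
    ring
  simp_rw [hpt] at h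
  have hadd : Integrable fun ω => X ω k ^ 2 * X ω k ^ 2 + X ω l ^ 2 * X ω l ^ 2 :=
    (hX.integrable_sq_mul_sq k k).add (hX.integrable_sq_mul_sq l l)
  rw [integral_div, integral_sub hadd ((hX.integrable_sq_mul_sq k l).const_mul 2),
    integral_add (hX.integrable_sq_mul_sq k k) (hX.integrable_sq_mul_sq l l), integral_const_mul,
    hX.integral_comp_coord_eq l k (f := fun y => y ^ 2 * y ^ 2) (by fun_prop)] at h
  linarith

lemma integral_sq_mul_sq [DecidableEq ι] (hX : IsUniformOnSphere X) (k l : ι) :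
    ∫ ω, X ω k ^ 2 * X ω l ^ 2 =
      (if k = l then (3 : ℝ) else 1) / (Fintype.card ι * (Fintype.card ι + 2)) := by
  have hne : ∀ m, m ≠ k →
      ∫ ω, X ω k ^ 2 * X ω m ^ 2 = (∫ ω, X ω k ^ 2 * X ω k ^ 2) / 3 := fun m hm => by
    linarith [hX.three_mul_integral_sq_mul_sq hm.symm]
  have hpos : (0 : ℝ) < Fintype.card ι := by
    have : Nonempty ι := ⟨k⟩
    exact_mod_cast Fintype.card_pos
  have hsum : ∑ m, ∫ ω, X ω k ^ 2 * X ω m ^ 2 = 1 / (Fintype.card ι : ℝ) := by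
    rw [← integral_finsetSum _ fun m _ => hX.integrable_sq_mul_sq k m, ← hX.integral_sq k]
    refine integral_congr_ae ?_
    filter_upwards [hX.ae_sum_sq] with ω h
    rw [← Finset.mul_sum, h, mul_one]
  have hdiag : ∫ ω, X ω k ^ 2 * X ω k ^ 2 =
      3 / (Fintype.card ι * (Fintype.card ι + 2) : ℝ) := by
    rw [← Finset.add_sum_erase _ _ (Finset.mem_univ k),
      Finset.sum_congr rfl fun m hm => hne m (Finset.ne_of_mem_erase hm), Finset.sum_const,
      nsmul_eq_mul, Finset.card_erase_of_mem (Finset.mem_univ k), Finset.card_univ,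
      Nat.cast_sub (by exact_mod_cast hpos), Nat.cast_one] at hsum
    field_simp at hsum ⊢
    linarith
  split_ifs with h
  · rw [← h, hdiag]
  · rw [hne l (Ne.symm h), hdiag]
    field_simp

/-- The variance of a diagonal quadratic form in a uniform vector on the sphere is at most
`2 / p²` times the sum of the squares of its coefficients. -/
lemma integral_sq_sub_mean_le (hX : IsUniformOnSphere X) (a : ι → ℝ) :
    ∫ ω, (∑ k, a k * X ω k ^ 2 - (∑ k, a k) / Fintype.card ι) ^ 2 ≤
      2 * (∑ k, a k ^ 2) / (Fintype.card ι : ℝ) ^ 2 := by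
  classical
  rcases isEmpty_or_nonempty ι with hι | hι
  · simp
  have hn : (0 : ℝ) < Fintype.card ι := by exact_mod_cast Fintype.card_pos
  set n : ℝ := (Fintype.card ι : ℝ) with hn_def
  set s : ℝ := ∑ k, a k with hs
  have hexp : ∀ ω, (∑ k, a k * X ω k ^ 2 - s / n) ^ 2 =
      ∑ k, ∑ l, a k * a l * (X ω k ^ 2 * X ω l ^ 2) -
        2 * (s / n) * ∑ k, a k * X ω k ^ 2 + (s / n) ^ 2 := by
    intro ω
    rw [sub_sq, sq (∑ k, a k * X ω k ^ 2), Finset.sum_mul_sum]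
    congr 1
    congr 1
    · exact Finset.sum_congr rfl fun k _ => Finset.sum_congr rfl fun l _ => by ring
    · ring
  have hi1 : ∀ k l, Integrable fun ω => a k * a l * (X ω k ^ 2 * X ω l ^ 2) :=
    fun k l => (hX.integrable_sq_mul_sq k l).const_mul _
  have hi1' : Integrable fun ω => ∑ k, ∑ l, a k * a l * (X ω k ^ 2 * X ω l ^ 2) :=
    integrable_finsetSum _ fun k _ => integrable_finsetSum _ fun l _ => hi1 k l
  have hi2 : ∀ k, Integrable fun ω => a k * X ω k ^ 2 :=
    fun k => (hX.integrable_sq k).const_mul _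
  have hi2' : Integrable fun ω => ∑ k, a k * X ω k ^ 2 := integrable_finsetSum _ fun k _ => hi2 k
  have hfirst : ∫ ω, ∑ k, a k * X ω k ^ 2 = s / n := by
    rw [integral_finsetSum _ fun k _ => hi2 k]
    simp_rw [integral_const_mul, hX.integral_sq]
    rw [← Finset.sum_mul, mul_one_div]
  have hsecond : ∫ ω, ∑ k, ∑ l, a k * a l * (X ω k ^ 2 * X ω l ^ 2) =
      (2 * ∑ k, a k ^ 2 + s ^ 2) / (n * (n + 2)) := by
    rw [integral_finsetSum _ fun k _ => integrable_finsetSum _ fun l _ => hi1 k l]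
    simp_rw [fun k => integral_finsetSum Finset.univ fun l _ => hi1 k l, integral_const_mul,
      hX.integral_sq_mul_sq, ← mul_div_assoc, ← Finset.sum_div]
    congr 1
    have hite : ∀ k l : ι, a k * a l * (if k = l then (3 : ℝ) else 1) =
        (if k = l then 2 * a k ^ 2 else 0) + a k * a l := by
      intro k l
      split_ifs with h
      · subst h
        ring
      · ring
    simp_rw [hite, Finset.sum_add_distrib, Finset.sum_ite_eq, Finset.mem_univ, if_true]
    rw [← Finset.mul_sum, sq s, hs, Finset.sum_mul_sum]
  simp_rw [hexp]
  have hsub : Integrable fun ω => ∑ k, ∑ l, a k * a l * (X ω k ^ 2 * X ω l ^ 2) -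
      2 * (s / n) * ∑ k, a k * X ω k ^ 2 := hi1'.sub (hi2'.const_mul _)
  rw [integral_add hsub (integrable_const _), integral_sub hi1' (hi2'.const_mul _),
    integral_const_mul, hfirst, hsecond, integral_const]
  simp only [probReal_univ, one_smul]
  have hS : 0 ≤ ∑ k, a k ^ 2 := Finset.sum_nonneg fun k _ => sq_nonneg _
  have hkey : 2 * (∑ k, a k ^ 2) / n ^ 2 -
      ((2 * ∑ k, a k ^ 2 + s ^ 2) / (n * (n + 2)) - 2 * (s / n) * (s / n) + (s / n) ^ 2) =
      (4 * (∑ k, a k ^ 2) + 2 * s ^ 2) / (n ^ 2 * (n + 2)) := by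
    field_simp
    ring
  have : 0 ≤ (4 * (∑ k, a k ^ 2) + 2 * s ^ 2) / (n ^ 2 * (n + 2)) := by positivity
  linarith

end IsUniformOnSphere

end UniformOnSphere

/-- The quadratic form of a Hermitian matrix, in coordinates along its eigenvector basis. -/
lemma Matrix.IsHermitian.sum_mul_mul_eq_sum_eigenvalues {n : Type*} [Fintype n] [DecidableEq n]
    {S : Matrix n n ℝ} (hS : S.IsHermitian) (x : EuclideanSpace ℝ n) :
    ∑ k, ∑ l, x k * S k l * x l =
      ∑ k, hS.eigenvalues k * hS.eigenvectorBasis.repr x k ^ 2 := by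
  have h1 : ∑ k, ∑ l, x k * S k l * x l = inner ℝ x (Matrix.toEuclideanLin S x) := by
    simp only [PiLp.inner_apply, Matrix.toLpLin_apply, Matrix.mulVec, dotProduct]
    refine Finset.sum_congr rfl fun k _ => ?_
    simp only [RCLike.inner_apply, conj_trivial, Finset.sum_mul]
    exact Finset.sum_congr rfl fun l _ => by ring
  have hsymm := Matrix.isSymmetric_toEuclideanLin_iff.2 hS
  rw [h1, ← hS.eigenvectorBasis.sum_inner_mul_inner]
  refine Finset.sum_congr rfl fun k _ => ?_
  have hev : Matrix.toEuclideanLin S (hS.eigenvectorBasis k) =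
      hS.eigenvalues k • hS.eigenvectorBasis k := by
    ext m
    simpa [Matrix.toLpLin_apply] using congrFun (hS.mulVec_eigenvectorBasis k) m
  rw [← hsymm, hev, inner_smul_left, hS.eigenvectorBasis.repr_apply_apply, real_inner_comm x]
  simp
  ring

/-- A first order expansion of `1 / q` around `1 / t`, with the product split by Young's
inequality with weight `r`. -/
lemma abs_div_sub_div_le {a q t c r : ℝ} (hc : 0 < c) (hq : c ≤ q) (ht : c ≤ t) (hr : 0 < r) :
    |a / q - a / t| ≤ (r * a ^ 2 + (q - t) ^ 2 / r) / (2 * c ^ 2) := by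
  have hq0 : 0 < q := hc.trans_le hq
  have ht0 : 0 < t := hc.trans_le ht
  have hyoung : |a * (t - q)| ≤ (r * a ^ 2 + (q - t) ^ 2 / r) / 2 := by
    have h : r * a ^ 2 + (q - t) ^ 2 / r - 2 * |a * (t - q)| = (r * |a| - |t - q|) ^ 2 / r := by
      rw [abs_mul, ← sq_abs a, ← sq_abs (q - t), abs_sub_comm q t]
      field_simp
      ring
    have : 0 ≤ (r * |a| - |t - q|) ^ 2 / r := by positivity
    linarith
  have hqt : c ^ 2 ≤ q * t := by nlinarith
  calc |a / q - a / t| = |a * (t - q)| / (q * t) := by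
        rw [div_sub_div _ _ hq0.ne' ht0.ne', abs_div, abs_of_pos (mul_pos hq0 ht0)]
        congr 2
        ring
    _ ≤ (r * a ^ 2 + (q - t) ^ 2 / r) / 2 / c ^ 2 := by gcongr
    _ = (r * a ^ 2 + (q - t) ^ 2 / r) / (2 * c ^ 2) := by rw [div_div]

/-- For every `c ∈ (0,1]` there is a constant `C > 0` (depending only on `c`) such that for
every symmetric positive definite `Σ` with all eigenvalues in `[c, 1/c]` and `u` uniform on
the sphere, `|E[u_i u_j / (uᵀ Σ u)] − δ_{ij}/tr(Σ)| ≤ C p^{−3/2}`. -/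
theorem expected_ratio_approx_uniform_sphere (c : ℝ) (hc : c ∈ Set.Ioc (0 : ℝ) 1) :
    ∃ C : ℝ, 0 < C ∧
      ∀ (p : ℕ), 1 ≤ p →
        ∀ (S : Matrix (Fin p) (Fin p) ℝ) (hherm : S.IsHermitian), S.PosDef →
          (∀ i, hherm.eigenvalues i ∈ Set.Icc c (1 / c)) →
          ∀ (Ω : Type) [MeasureSpace Ω] [IsProbabilityMeasure (volume : Measure Ω)],
            ∀ X : Ω → EuclideanSpace ℝ (Fin p), IsUniformOnSphere X →
              ∀ i j : Fin p,
                |(∫ ω, X ω i * X ω j / (∑ k, ∑ l, X ω k * S k l * X ω l)) -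
                    (if i = j then (1 : ℝ) else 0) / S.trace|
                  ≤ C * (p : ℝ) ^ (-(3 / 2) : ℝ) := by
  have hc0 : 0 < c := hc.1
  refine ⟨(3 / 2 + 1 / c ^ 2) / c ^ 2, by positivity, ?_⟩
  intro p hp S hS _ hev Ω _ _ X hX i j
  have hp0 : (0 : ℝ) < p := by exact_mod_cast hp
  set r : ℝ := √(p : ℝ) with hr_def
  have hr : 0 < r := Real.sqrt_pos.2 hp0
  have hr2 : r ^ 2 = p := Real.sq_sqrt hp0.le
  set t : ℝ := (∑ k, hS.eigenvalues k) / p with ht_def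
  have htrace : S.trace = p * t := by
    rw [hS.trace_eq_sum_eigenvalues, ht_def]
    simp only [RCLike.ofReal_real_eq_id, id]
    field_simp
  have htc : c ≤ t := by
    rw [ht_def, le_div_iff₀ hp0]
    have := Finset.card_nsmul_le_sum Finset.univ hS.eigenvalues c fun k _ => (hev k).1
    simpa [mul_comm] using this
  have ht0 : 0 < t := hc0.trans_le htc
  have hY := hX.isometry_comp hS.eigenvectorBasis.repr
  have hm := hX.measurable_coord
  have hmY := hY.measurable_coord
  simp_rw [hS.sum_mul_mul_eq_sum_eigenvalues]
  set q : Ω → ℝ := fun ω => ∑ k, hS.eigenvalues k * hS.eigenvectorBasis.repr (X ω) k ^ 2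
    with hq_def
  have hqm : Measurable q :=
    Finset.measurable_fun_sum _ fun k _ => ((hmY k).pow_const 2).const_mul _
  have hqc : ∀ᵐ ω, c ≤ q ω := by
    filter_upwards [hY.ae_sum_sq] with ω h
    calc c = ∑ k, c * hS.eigenvectorBasis.repr (X ω) k ^ 2 := by
          rw [← Finset.mul_sum, h, mul_one]
      _ ≤ q ω := Finset.sum_le_sum fun k _ => by
          have := (hev k).1
          gcongr
  have hqC : ∀ᵐ ω, q ω ≤ 1 / c := by
    filter_upwards [hY.ae_sum_sq] with ω h
    calc q ω ≤ ∑ k, 1 / c * hS.eigenvectorBasis.repr (X ω) k ^ 2 :=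
          Finset.sum_le_sum fun k _ => by
            have := (hev k).2
            gcongr
      _ = 1 / c := by rw [← Finset.mul_sum, h, mul_one]
  have hint1 : Integrable fun ω => X ω i * X ω j / q ω := by
    refine Integrable.of_bound (C := 1 / c) (((hm i).mul (hm j)).div hqm).aestronglyMeasurable ?_
    filter_upwards [hX.ae_abs_coord_le i, hX.ae_abs_coord_le j, hqc] with ω hi hj hq
    rw [Real.norm_eq_abs, abs_div, abs_mul, abs_of_pos (hc0.trans_le hq)]
    exact div_le_div₀ zero_le_one (mul_le_one₀ hi (abs_nonneg _) hj) hc0 hq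
  have hint2 : Integrable fun ω => X ω i * X ω j / t := (hX.integrable_mul i j).div_const t
  have hint3 : Integrable fun ω => (X ω i * X ω j) ^ 2 := by
    simpa only [mul_pow] using hX.integrable_sq_mul_sq i j
  have hint4 : Integrable fun ω => (q ω - t) ^ 2 := by
    refine Integrable.of_bound (C := (1 / c + t) ^ 2)
      ((hqm.sub_const t).pow_const 2).aestronglyMeasurable ?_
    filter_upwards [hqc, hqC] with ω h1 h2
    rw [Real.norm_eq_abs, abs_of_nonneg (sq_nonneg _)]
    exact sq_le_sq' (by linarith) (by linarith)
  have hmean : (if i = j then (1 : ℝ) else 0) / S.trace = ∫ ω, X ω i * X ω j / t := by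
    rw [integral_div, hX.integral_mul, Fintype.card_fin, htrace, div_div]
  have hfourth : ∫ ω, (X ω i * X ω j) ^ 2 ≤ 3 / (p : ℝ) ^ 2 := by
    simp_rw [mul_pow]
    rw [hX.integral_sq_mul_sq, Fintype.card_fin]
    refine div_le_div₀ (by norm_num) (by split_ifs <;> norm_num) (by positivity) ?_
    nlinarith
  have hvar : ∫ ω, (q ω - t) ^ 2 ≤ 2 / (c ^ 2 * p) := by
    have h := hY.integral_sq_sub_mean_le hS.eigenvalues
    rw [Fintype.card_fin] at h
    refine h.trans ?_
    have hsq : ∑ k, hS.eigenvalues k ^ 2 ≤ p * (1 / c) ^ 2 := by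
      have := Finset.sum_le_card_nsmul Finset.univ (fun k => hS.eigenvalues k ^ 2) ((1 / c) ^ 2)
        fun k _ => pow_le_pow_left₀ (hc0.le.trans (hev k).1) (hev k).2 2
      simpa using this
    calc 2 * (∑ k, hS.eigenvalues k ^ 2) / (p : ℝ) ^ 2
        ≤ 2 * (p * (1 / c) ^ 2) / (p : ℝ) ^ 2 := by gcongr
      _ = 2 / (c ^ 2 * p) := by field_simp
  have hpow : (p : ℝ) ^ (-(3 / 2) : ℝ) = 1 / r ^ 3 := by
    rw [Real.rpow_neg hp0.le, one_div, hr_def, Real.sqrt_eq_rpow, ← Real.rpow_mul_natCast hp0.le]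
    norm_num
  rw [hmean, ← integral_sub hint1 hint2, hpow]
  calc |∫ ω, (X ω i * X ω j / q ω - X ω i * X ω j / t)|
      ≤ ∫ ω, |X ω i * X ω j / q ω - X ω i * X ω j / t| := abs_integral_le_integral_abs
    _ ≤ ∫ ω, (r * (X ω i * X ω j) ^ 2 + (q ω - t) ^ 2 / r) / (2 * c ^ 2) := by
        refine integral_mono_ae (hint1.sub hint2).abs
          (((hint3.const_mul r).add (hint4.div_const r)).div_const _) ?_
        filter_upwards [hqc] with ω h
        exact abs_div_sub_div_le hc0 h htc hr
    _ = (r * (∫ ω, (X ω i * X ω j) ^ 2) + (∫ ω, (q ω - t) ^ 2) / r) / (2 * c ^ 2) := by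
        rw [integral_div, integral_add (hint3.const_mul r) (hint4.div_const r),
          integral_const_mul, integral_div]
    _ ≤ (r * (3 / (p : ℝ) ^ 2) + 2 / (c ^ 2 * p) / r) / (2 * c ^ 2) := by gcongr
    _ = (3 / 2 + 1 / c ^ 2) / c ^ 2 * (1 / r ^ 3) := by
        rw [← hr2]
        field_simp
end
end

section
/- Let M and Δ be p×p real symmetric matrices such that M + νΔ is positive definite for every ν ∈ [0,1]. Then log det(M + Δ) − log det(M) = tr(M⁻¹ Δ) − ∫₀¹ (1−ν) · tr((M+νΔ)⁻¹ Δ (M+νΔ)⁻¹ Δ) dν. -/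
open MeasureTheory Matrix

noncomputable section

section Derivatives

variable {n : Type*} [Fintype n] [DecidableEq n]

attribute [local instance] Matrix.linftyOpNormedRing Matrix.linftyOpNormedAlgebra

theorem Matrix.hasDerivAt_inv_add_smul (A B : Matrix n n ℝ) (t : ℝ)
    (h : IsUnit (A + t • B)) :
    HasDerivAt (fun s : ℝ => (A + s • B)⁻¹)
      (-((A + t • B)⁻¹ * B * (A + t • B)⁻¹)) t := by
  obtain ⟨u, hu⟩ := h
  have h₁ : HasDerivAt (fun s : ℝ => A + s • B) B t :=
    (((hasDerivAt_id t).smul_const B).const_add A).congr_deriv (one_smul ℝ B)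
  have h₂ := hasFDerivAt_ringInverse (𝕜 := ℝ) u
  rw [hu] at h₂
  have h₃ := h₂.comp_hasDerivAt t h₁
  simp only [Matrix.nonsing_inv_eq_ringInverse]
  rw [← hu, Ring.inverse_unit]
  refine h₃.congr_deriv ?_
  simp

theorem Matrix.hasDerivAt_trace_inv_add_smul_mul (A B C : Matrix n n ℝ) (t : ℝ)
    (h : IsUnit (A + t • B)) :
    HasDerivAt (fun s : ℝ => ((A + s • B)⁻¹ * C).trace)
      (-((A + t • B)⁻¹ * B * (A + t • B)⁻¹ * C).trace) t := by
  have h₁ := (hasDerivAt_inv_add_smul A B t h).mul_const C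
  have h₂ := (LinearMap.toContinuousLinearMap
    (Matrix.traceLinearMap n ℝ ℝ)).hasFDerivAt.comp_hasDerivAt t h₁
  refine h₂.congr_deriv ?_
  rw [neg_mul]
  exact Matrix.trace_neg ((A + t • B)⁻¹ * B * (A + t • B)⁻¹ * C)

theorem Matrix.continuousAt_inv_add_smul (A B : Matrix n n ℝ) (t : ℝ)
    (h : IsUnit (A + t • B)) :
    ContinuousAt (fun s : ℝ => (A + s • B)⁻¹) t :=
  (hasDerivAt_inv_add_smul A B t h).continuousAt

end Derivatives

theorem Matrix.hasDerivAt_det_one_add_smul {n : Type*} [Fintype n] [DecidableEq n]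
    (A : Matrix n n ℝ) : HasDerivAt (fun s : ℝ => (1 + s • A).det) A.trace 0 := by
  obtain ⟨q, hq⟩ : ∃ q : Polynomial ℝ, ∀ s : ℝ,
      (1 + s • A).det = 1 + A.trace * s + q.eval s * s ^ 2 :=
    ⟨_, fun s => Matrix.det_one_add_smul s A⟩
  rw [funext hq]
  refine HasDerivAt.congr_deriv (((hasDerivAt_const (0 : ℝ) (1 : ℝ)).add
    ((hasDerivAt_id (0 : ℝ)).const_mul A.trace)).add
    ((q.hasDerivAt (0 : ℝ)).mul ((hasDerivAt_id (0 : ℝ)).pow 2))) ?_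
  simp

/-- Jacobi's formula along an affine line, at an invertible matrix. -/
theorem Matrix.hasDerivAt_det_add_smul {n : Type*} [Fintype n] [DecidableEq n]
    (A B : Matrix n n ℝ) (t : ℝ) (h : IsUnit (A + t • B)) :
    HasDerivAt (fun s : ℝ => (A + s • B).det)
      ((A + t • B).det * ((A + t • B)⁻¹ * B).trace) t := by
  have key (s : ℝ) : (A + s • B).det =
      (A + t • B).det * (1 + (s - t) • ((A + t • B)⁻¹ * B)).det := by
    rw [← Matrix.det_mul, mul_add, mul_one, Matrix.mul_smul,
      Matrix.mul_nonsing_inv_cancel_left _ _ ((Matrix.isUnit_iff_isUnit_det _).mp h)]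
    congr 1
    module
  have h₁ := hasDerivAt_det_one_add_smul ((A + t • B)⁻¹ * B)
  rw [← sub_self t] at h₁
  simp_rw [funext key]
  exact (h₁.comp_sub_const t t).const_mul _

/-- Taylor expansion of `log det` along the segment from `M` to `M + Δ`:
`log det(M+Δ) − log det(M) = tr(M⁻¹Δ) − ∫₀¹ (1−ν) tr((M+νΔ)⁻¹ Δ (M+νΔ)⁻¹ Δ) dν`. -/
theorem logDet_taylor_expansion {p : ℕ}
    (M Δ : Matrix (Fin p) (Fin p) ℝ) (hM : M.IsSymm) (hΔ : Δ.IsSymm)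
    (hpos : ∀ ν ∈ Set.Icc (0 : ℝ) 1, (M + ν • Δ).PosDef) :
    Real.log (M + Δ).det - Real.log M.det =
      (M⁻¹ * Δ).trace -
        ∫ ν in (0 : ℝ)..1,
          (1 - ν) * ((M + ν • Δ)⁻¹ * Δ * (M + ν • Δ)⁻¹ * Δ).trace := by
  have hderiv : ∀ ν ∈ Set.uIcc (0 : ℝ) 1, HasDerivAt
      (fun s : ℝ => -(Real.log (M + s • Δ).det + (1 - s) * ((M + s • Δ)⁻¹ * Δ).trace))
      ((1 - ν) * ((M + ν • Δ)⁻¹ * Δ * (M + ν • Δ)⁻¹ * Δ).trace) ν := by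
    intro ν hν
    rw [Set.uIcc_of_le zero_le_one] at hν
    have hdet := (hpos ν hν).det_pos.ne'
    have hunit := (hpos ν hν).isUnit
    refine (((hasDerivAt_det_add_smul M Δ ν hunit).log hdet).add
      (((hasDerivAt_id ν).const_sub 1).mul
        (hasDerivAt_trace_inv_add_smul_mul M Δ Δ ν hunit))).neg.congr_deriv ?_
    rw [mul_div_cancel_left₀ _ hdet]
    simp only [id]
    ring
  have hcont : ContinuousOn (fun ν : ℝ =>
      (1 - ν) * ((M + ν • Δ)⁻¹ * Δ * (M + ν • Δ)⁻¹ * Δ).trace) (Set.uIcc 0 1) := by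
    intro ν hν
    rw [Set.uIcc_of_le zero_le_one] at hν
    have hinv := continuousAt_inv_add_smul M Δ ν (hpos ν hν).isUnit
    have htrace : Continuous fun X : Matrix (Fin p) (Fin p) ℝ => (X * Δ * X * Δ).trace := by
      fun_prop
    exact ((continuousAt_const.sub continuousAt_id).mul
      (htrace.continuousAt.comp hinv)).continuousWithinAt
  rw [intervalIntegral.integral_eq_sub_of_hasDerivAt hderiv hcont.intervalIntegrable]
  simp only [one_smul, zero_smul, add_zero, sub_self, zero_mul, sub_zero, one_mul]
  ring
end
end
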